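/- arXiv:2604.27341 — 2 statements merged into one kernel-verified Lean document; each statement's English description precedes it below -/
import Mathlib

section
/- For q = 2 and p ≥ 3, the elimination ideal I = ⟨t² + e_p t + e_{2p}, e_1 t + e_{p+1}, ..., e_{p-1} t + e_{2p-1}⟩ ∩ k[e_1,...,e_{2p}] is generated by the 3×3 minors of the 3×(2p-1) matrix A whose columns are (1, e_p, e_{2p}) together with, for each 1 ≤ i ≤ p-1, the two columns (e_i, e_{p+i}, 0) and (0, e_i, e_{p+i}). -/
/-- The generators `f₀ = t² + e_p t + e_{2p}` and `f_i = e_i t + e_{p+i}`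
(1 ≤ i ≤ p-1) in `k[e_1,…,e_{2p}][t]` (variables 0-indexed). -/
noncomputable def q2Gens (k : Type*) [Field k] (p : ℕ) (hp : 3 ≤ p) :
    Set (Polynomial (MvPolynomial (Fin (2 * p)) k)) :=
  insert
    (Polynomial.X ^ 2 +
      Polynomial.C (MvPolynomial.X ⟨p - 1, by omega⟩) * Polynomial.X +
      Polynomial.C (MvPolynomial.X ⟨2 * p - 1, by omega⟩))
    {g | ∃ j : Fin (p - 1),
      g = Polynomial.C (MvPolynomial.X (⟨(j : ℕ), by have := j.isLt; omega⟩ : Fin (2 * p))) *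
            Polynomial.X +
          Polynomial.C (MvPolynomial.X (⟨p + (j : ℕ), by have := j.isLt; omega⟩ : Fin (2 * p)))}

/-- The `3 × (2p-1)` matrix `A` whose columns are `(1, e_p, e_{2p})` and, for each
`1 ≤ i ≤ p-1`, the pair `(e_i, e_{p+i}, 0)` (odd-numbered columns) and
`(0, e_i, e_{p+i})` (even-numbered columns); variables 0-indexed. -/
noncomputable def matA (k : Type*) [Field k] (p : ℕ) (hp : 3 ≤ p) :
    Matrix (Fin 3) (Fin (2 * p - 1)) (MvPolynomial (Fin (2 * p)) k) := fun r c =>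
  match c with
  | ⟨cv, hcv⟩ =>
    if cv = 0 then
      (if r = 0 then 1
        else if r = 1 then MvPolynomial.X ⟨p - 1, by omega⟩
        else MvPolynomial.X ⟨2 * p - 1, by omega⟩)
    else if cv % 2 = 1 then
      (if r = 0 then MvPolynomial.X ⟨(cv + 1) / 2 - 1, by omega⟩
        else if r = 1 then MvPolynomial.X ⟨p + (cv + 1) / 2 - 1, by omega⟩
        else 0)
    else
      (if r = 0 then 0
        else if r = 1 then MvPolynomial.X ⟨cv / 2 - 1, by omega⟩
        else MvPolynomial.X ⟨p + cv / 2 - 1, by omega⟩)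

/-- If `X_m * q` lies in an ideal generated by variables other than `X_m`, then so does `q`. -/
theorem MvPolynomial.mem_span_X_image_of_mul_X_mem {σ R : Type*} [CommSemiring R] {s : Set σ}
    {m : σ} (hm : m ∉ s) {q : MvPolynomial σ R}
    (h : q * MvPolynomial.X m ∈ Ideal.span (MvPolynomial.X '' s : Set (MvPolynomial σ R))) :
    q ∈ Ideal.span (MvPolynomial.X '' s : Set (MvPolynomial σ R)) := by
  rw [MvPolynomial.mem_ideal_span_X_image] at h ⊢
  intro d hd
  obtain ⟨i, hi, hne⟩ := h (d + Finsupp.single m 1) (by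
    rw [MvPolynomial.support_mul_X]
    exact Finset.mem_map_of_mem _ hd)
  have him : m ≠ i := fun e => hm (e ▸ hi)
  exact ⟨i, hi, by simpa [Finsupp.single_apply, him] using hne⟩

/-- Syzygies of distinct variables are Koszul: such a syzygy pairs with any family `w` to an
element of the ideal generated by the `2 × 2` minors of the variables against `w`. -/
theorem MvPolynomial.sum_mul_mem_of_sum_mul_X_eq_zero {σ ι R : Type*} [CommRing R]
    {f : ι → σ} (hf : Function.Injective f) (w : ι → MvPolynomial σ R)
    (I : Ideal (MvPolynomial σ R))
    (hI : ∀ i j, MvPolynomial.X (f i) * w j - MvPolynomial.X (f j) * w i ∈ I)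
    (T : Finset ι) (c : ι → MvPolynomial σ R)
    (hc : ∑ i ∈ T, c i * MvPolynomial.X (f i) = 0) :
    ∑ i ∈ T, c i * w i ∈ I := by
  classical
  induction T using Finset.induction_on generalizing c with
  | empty => simp
  | insert m T hm ih =>
    rw [Finset.sum_insert hm] at hc ⊢
    have hcm : c m ∈ Ideal.span
        (MvPolynomial.X '' (f '' (T : Set ι)) : Set (MvPolynomial σ R)) := by
      apply MvPolynomial.mem_span_X_image_of_mul_X_mem (m := f m)
      · rintro ⟨i, hi, e⟩
        exact hm (hf e ▸ hi)
      · rw [eq_neg_of_add_eq_zero_left hc]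
        exact neg_mem (sum_mem fun i hi => Ideal.mul_mem_left _ _
          (Ideal.subset_span ⟨_, ⟨i, hi, rfl⟩, rfl⟩))
    rw [Set.image_image, Ideal.span, Submodule.mem_span_image_finset_iff_exists_fun'] at hcm
    obtain ⟨d, hd⟩ := hcm
    simp only [smul_eq_mul] at hd
    have key := ih (fun i => c i + d i * MvPolynomial.X (f m)) (by
      rw [← hc, ← hd, Finset.sum_mul, add_comm, ← Finset.sum_add_distrib]
      exact Finset.sum_congr rfl fun i _ => by ring)
    have hminors : ∑ i ∈ T, d i * (MvPolynomial.X (f i) * w m - MvPolynomial.X (f m) * w i) ∈ I :=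
      sum_mem fun i _ => Ideal.mul_mem_left _ _ (hI i m)
    convert add_mem key hminors using 1
    rw [← hd, Finset.sum_mul, add_comm, ← Finset.sum_add_distrib, ← Finset.sum_add_distrib]
    exact Finset.sum_congr rfl fun i _ => by ring

/-- Remainder of a multiple of a linear polynomial modulo a monic quadratic one. -/
theorem Polynomial.exists_mul_linear_modByMonic_eq {R : Type*} [CommRing R] (s u a b : R)
    (h : Polynomial R) :
    ∃ c d : R, (h * (Polynomial.C a * Polynomial.X + Polynomial.C b)) %ₘ
        (Polynomial.X ^ 2 + Polynomial.C s * Polynomial.X + Polynomial.C u) =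
      Polynomial.C (c * a + d * (b - s * a)) * Polynomial.X +
        Polynomial.C (c * b - d * (u * a)) := by
  nontriviality R
  set F : Polynomial R := Polynomial.X ^ 2 + Polynomial.C s * Polynomial.X + Polynomial.C u
    with hF
  have hdeg : F.degree = 2 := by
    rw [hF]; compute_degree!
  have hmonic : F.Monic := by
    rw [hF]; monicity!
  have hr : (h %ₘ F).degree ≤ 1 := by
    have := Polynomial.degree_modByMonic_lt h hmonic
    rw [hdeg] at this
    exact Order.le_of_lt_succ this
  obtain ⟨d, c, hcd⟩ : ∃ d c : R, h %ₘ F = Polynomial.C d * Polynomial.X + Polynomial.C c :=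
    ⟨_, _, Polynomial.eq_X_add_C_of_degree_le_one hr⟩
  refine ⟨c, d, (Polynomial.div_modByMonic_unique
    ((h /ₘ F) * (Polynomial.C a * Polynomial.X + Polynomial.C b) + Polynomial.C (d * a)) _
    hmonic ⟨?_, ?_⟩).2⟩
  · have hh := Polynomial.modByMonic_add_div h F
    rw [hcd] at hh
    generalize h /ₘ F = Q at hh ⊢
    rw [hF] at hh ⊢
    simp only [map_add, map_sub, map_mul]
    linear_combination (Polynomial.C a * Polynomial.X + Polynomial.C b) * hh
  · rw [hdeg]
    exact lt_of_le_of_lt Polynomial.degree_linear_le (by norm_num)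

section Columns

variable (k : Type*) [Field k] (p : ℕ) (hp : 3 ≤ p)

theorem matA_column_zero (h : 0 < 2 * p - 1) :
    (matA k p hp).col ⟨0, h⟩ =
      ![1, MvPolynomial.X ⟨p - 1, by omega⟩, MvPolynomial.X ⟨2 * p - 1, by omega⟩] := by
  ext1 r
  fin_cases r <;> simp [matA, Matrix.col]

theorem matA_column_odd (i : ℕ) (hi : i < p - 1) :
    (matA k p hp).col ⟨2 * i + 1, by omega⟩ =
      ![MvPolynomial.X ⟨i, by omega⟩, MvPolynomial.X ⟨p + i, by omega⟩, 0] := by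
  have h1 : (2 * i + 1 + 1) / 2 - 1 = i := by omega
  have h2 : p + (2 * i + 1 + 1) / 2 - 1 = p + i := by omega
  have h3 : (2 * i + 1) % 2 = 1 := by omega
  ext1 r
  fin_cases r <;> simp [matA, Matrix.col, h1, h2, h3]

theorem matA_column_even (i : ℕ) (hi : i < p - 1) :
    (matA k p hp).col ⟨2 * i + 2, by omega⟩ =
      ![0, MvPolynomial.X ⟨i, by omega⟩, MvPolynomial.X ⟨p + i, by omega⟩] := by
  ext1 r
  fin_cases r <;> simp [matA, Matrix.col]

/-- The row vector `(t², t, 1)` times `A` has all its entries in the ideal of the generators. -/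
theorem row_mul_matA_mem_span_q2Gens (c : Fin (2 * p - 1)) :
    Polynomial.X ^ 2 * Polynomial.C (matA k p hp 0 c) +
        Polynomial.X * Polynomial.C (matA k p hp 1 c) + Polynomial.C (matA k p hp 2 c) ∈
      Ideal.span (q2Gens k p hp) := by
  obtain ⟨c, hc⟩ := c
  have entry : ∀ r, matA k p hp r ⟨c, hc⟩ = (matA k p hp).col ⟨c, hc⟩ r := fun _ => rfl
  simp only [entry]
  obtain rfl | ⟨i, hi, rfl | rfl⟩ : c = 0 ∨ ∃ i, i < p - 1 ∧ (c = 2 * i + 1 ∨ c = 2 * i + 2) := by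
    by_cases h : c = 0
    · exact .inl h
    · exact .inr ⟨(c - 1) / 2, by omega, by omega⟩
  · rw [matA_column_zero]
    refine (congrArg (· ∈ Ideal.span (q2Gens k p hp)) ?_).mpr
      (Ideal.subset_span (Set.mem_insert _ _))
    simp
  · rw [matA_column_odd k p hp i hi]
    refine (congrArg (· ∈ Ideal.span (q2Gens k p hp)) ?_).mpr
      (Ideal.mul_mem_left _ Polynomial.X
        (Ideal.subset_span (Set.mem_insert_of_mem _ ⟨⟨i, hi⟩, rfl⟩)))
    simp
    ring
  · rw [matA_column_even k p hp i hi]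
    refine (congrArg (· ∈ Ideal.span (q2Gens k p hp)) ?_).mpr
      (Ideal.subset_span (Set.mem_insert_of_mem _ ⟨⟨i, hi⟩, rfl⟩))
    simp

/-- The ideal of `3 × 3` minors of `A` (with the columns taken in any order). -/
noncomputable def minorsIdeal : Ideal (MvPolynomial (Fin (2 * p)) k) :=
  Ideal.span {m | ∃ cols : Fin 3 → Fin (2 * p - 1), Function.Injective cols ∧
    m = ((matA k p hp).submatrix id cols).det}

theorem minorsIdeal_le_comap :
    minorsIdeal k p hp ≤ Ideal.comap Polynomial.C (Ideal.span (q2Gens k p hp)) := by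
  refine Ideal.span_le.mpr ?_
  rintro _ ⟨cols, -, rfl⟩
  rw [SetLike.mem_coe, Ideal.mem_comap]
  have hrow := fun j => row_mul_matA_mem_span_q2Gens k p hp (cols j)
  set M := matA k p hp
  have hmem := add_mem (add_mem
    (Ideal.mul_mem_left _ (Polynomial.C
      (M 0 (cols 1) * M 1 (cols 2) - M 0 (cols 2) * M 1 (cols 1))) (hrow 0))
    (Ideal.mul_mem_left _ (Polynomial.C
      (M 0 (cols 2) * M 1 (cols 0) - M 0 (cols 0) * M 1 (cols 2))) (hrow 1)))
    (Ideal.mul_mem_left _ (Polynomial.C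
      (M 0 (cols 0) * M 1 (cols 1) - M 0 (cols 1) * M 1 (cols 0))) (hrow 2))
  convert hmem using 1
  rw [Matrix.det_fin_three]
  simp only [Matrix.submatrix_apply, id, map_add, map_sub, map_mul]
  ring

theorem det_mem_minorsIdeal {c₀ c₁ c₂ : Fin (2 * p - 1)} (h₀₁ : c₀ ≠ c₁) (h₀₂ : c₀ ≠ c₂)
    (h₁₂ : c₁ ≠ c₂) {u v w : Fin 3 → MvPolynomial (Fin (2 * p)) k}
    (hu : (matA k p hp).col c₀ = u) (hv : (matA k p hp).col c₁ = v)
    (hw : (matA k p hp).col c₂ = w) :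
    u 0 * v 1 * w 2 - u 0 * w 1 * v 2 - v 0 * u 1 * w 2 + v 0 * w 1 * u 2 + w 0 * u 1 * v 2 -
      w 0 * v 1 * u 2 ∈ minorsIdeal k p hp := by
  subst hu hv hw
  refine Ideal.subset_span ⟨![c₀, c₁, c₂], ?_, ?_⟩
  · intro i j
    fin_cases i <;> fin_cases j <;> simp [h₀₁, h₀₂, h₁₂, h₀₁.symm, h₀₂.symm, h₁₂.symm]
  · rw [Matrix.det_fin_three]
    simp [Matrix.col]

theorem even_even_minor_mem (i j : Fin (p - 1)) :
    (MvPolynomial.X ⟨i, by omega⟩ * MvPolynomial.X ⟨p + j, by omega⟩ -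
      MvPolynomial.X ⟨j, by omega⟩ * MvPolynomial.X ⟨p + i, by omega⟩ :
        MvPolynomial (Fin (2 * p)) k) ∈ minorsIdeal k p hp := by
  obtain rfl | hij := eq_or_ne i j
  · simp
  · have hij' : (i : ℕ) ≠ j := fun e => hij (Fin.ext e)
    simpa using det_mem_minorsIdeal k p hp (c₀ := ⟨0, by omega⟩) (by simp) (by simp)
      (by simpa using hij') (matA_column_zero k p hp (by omega)) (matA_column_even k p hp i i.isLt)
      (matA_column_even k p hp j j.isLt)

theorem odd_even_minor_mem (i j : Fin (p - 1)) :
    (MvPolynomial.X ⟨p + i, by omega⟩ * MvPolynomial.X ⟨p + j, by omega⟩ -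
      MvPolynomial.X ⟨i, by omega⟩ *
        (MvPolynomial.X ⟨p - 1, by omega⟩ * MvPolynomial.X ⟨p + j, by omega⟩ -
          MvPolynomial.X ⟨2 * p - 1, by omega⟩ * MvPolynomial.X ⟨j, by omega⟩) :
        MvPolynomial (Fin (2 * p)) k) ∈ minorsIdeal k p hp := by
  have h := det_mem_minorsIdeal k p hp (c₀ := ⟨0, by omega⟩) (by simp) (by simp)
    (by simp only [ne_eq, Fin.mk.injEq]; omega)
    (matA_column_zero k p hp (by omega)) (matA_column_odd k p hp i i.isLt)
    (matA_column_even k p hp j j.isLt)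
  convert h using 1
  simp
  ring

theorem comap_le_minorsIdeal :
    Ideal.comap Polynomial.C (Ideal.span (q2Gens k p hp)) ≤ minorsIdeal k p hp := by
  intro x hx
  let S := MvPolynomial (Fin (2 * p)) k
  let a : Fin (p - 1) → S := fun j => MvPolynomial.X ⟨j, by omega⟩
  let b : Fin (p - 1) → S := fun j => MvPolynomial.X ⟨p + j, by omega⟩
  let s : S := MvPolynomial.X ⟨p - 1, by omega⟩
  let u : S := MvPolynomial.X ⟨2 * p - 1, by omega⟩
  let F : Polynomial S := Polynomial.X ^ 2 + Polynomial.C s * Polynomial.X + Polynomial.C u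
  have hdeg : F.degree = 2 := by
    simp only [F]; compute_degree!
  have hmonic : F.Monic := by
    simp only [F]; monicity!
  obtain ⟨g, z, hz, hxz⟩ := Ideal.mem_span_insert.mp (Ideal.mem_comap.mp hx)
  have hset : {g : Polynomial S | ∃ j : Fin (p - 1), g = Polynomial.C (a j) * Polynomial.X +
      Polynomial.C (b j)} = Set.range fun j => Polynomial.C (a j) * Polynomial.X +
      Polynomial.C (b j) := by
    ext; simp [eq_comm]
  change z ∈ Ideal.span {g : Polynomial S | ∃ j : Fin (p - 1),
    g = Polynomial.C (a j) * Polynomial.X + Polynomial.C (b j)} at hz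
  change Polynomial.C x = g * F + z at hxz
  rw [hset, Ideal.mem_span_range_iff_exists_fun] at hz
  obtain ⟨h, rfl⟩ := hz
  choose c d hcd using fun j => Polynomial.exists_mul_linear_modByMonic_eq s u (a j) (b j) (h j)
  have hmod : Polynomial.C x = ∑ j, (Polynomial.C (c j * a j + d j * (b j - s * a j)) *
      Polynomial.X + Polynomial.C (c j * b j - d j * (u * a j))) := by
    calc Polynomial.C x = Polynomial.C x %ₘ F :=
          ((Polynomial.modByMonic_eq_self_iff hmonic).mpr
            (lt_of_le_of_lt Polynomial.degree_C_le (by rw [hdeg]; norm_num))).symm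
      _ = (∑ j, h j * (Polynomial.C (a j) * Polynomial.X + Polynomial.C (b j))) %ₘ F := by
          rw [hxz, Polynomial.add_modByMonic,
            (Polynomial.modByMonic_eq_zero_iff_dvd hmonic).mpr (dvd_mul_left F g), zero_add]
      _ = ∑ j, (h j * (Polynomial.C (a j) * Polynomial.X + Polynomial.C (b j))) %ₘ F :=
          map_sum (Polynomial.modByMonicHom F) _ _
      _ = _ := Finset.sum_congr rfl fun j _ => hcd j
  have h0 := congrArg (Polynomial.coeff · 0) hmod
  have h1 := congrArg (Polynomial.coeff · 1) hmod
  simp only [Polynomial.finsetSum_coeff, Polynomial.coeff_add, Polynomial.coeff_C_mul,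
    Polynomial.coeff_X_zero, Polynomial.coeff_X_one, Polynomial.coeff_C_zero,
    Polynomial.coeff_C_of_ne_zero one_ne_zero, mul_zero, mul_one, zero_add, add_zero] at h0 h1
  let f : Fin (p - 1) ⊕ Fin (p - 1) → Fin (2 * p) :=
    Sum.elim (fun j => ⟨j, by omega⟩) (fun j => ⟨p + j, by omega⟩)
  have hf : Function.Injective f := by
    rintro (i | i) (j | j) e <;> simp only [f, Sum.elim_inl, Sum.elim_inr, Fin.mk.injEq] at e
    · exact congrArg _ (Fin.ext e)
    · omega
    · omega
    · exact congrArg _ (Fin.ext (by omega))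
  have key := MvPolynomial.sum_mul_mem_of_sum_mul_X_eq_zero hf
    (Sum.elim b fun j => s * b j - u * a j) (minorsIdeal k p hp) ?_ Finset.univ
    (Sum.elim (fun j => c j - s * d j) d) ?_
  · convert key using 1
    rw [h0, Fintype.sum_sum_type, ← Finset.sum_add_distrib]
    refine Finset.sum_congr rfl fun j _ => ?_
    simp only [Sum.elim_inl, Sum.elim_inr]
    ring
  · rintro (i | i) (j | j) <;> simp only [f, Sum.elim_inl, Sum.elim_inr]
    · exact even_even_minor_mem k p hp i j
    · convert neg_mem (odd_even_minor_mem k p hp i j) using 1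
      simp only [a, b, s, u]
      ring
    · convert odd_even_minor_mem k p hp j i using 1
      simp only [a, b, s, u]
      ring
    · convert Ideal.mul_mem_left _ u (even_even_minor_mem k p hp i j) using 1
      simp only [a, b, s, u]
      ring
  · rw [Fintype.sum_sum_type, ← Finset.sum_add_distrib, h1]
    refine Finset.sum_congr rfl fun j _ => ?_
    simp only [f, Sum.elim_inl, Sum.elim_inr, a, b]
    ring

end Columns

/-- for `q = 2` and `p ≥ 3`, the elimination ideal
`⟨f₀, f₁, …, f_{p-1}⟩ ∩ k[e_1,…,e_{2p}]` is generated by the `3×3` minors of `A`. -/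
theorem stmt10 (k : Type*) [Field k] (p : ℕ) (hp : 3 ≤ p) :
    Ideal.comap (Polynomial.C : MvPolynomial (Fin (2 * p)) k →+*
        Polynomial (MvPolynomial (Fin (2 * p)) k)) (Ideal.span (q2Gens k p hp)) =
      Ideal.span {m | ∃ cols : Fin 3 → Fin (2 * p - 1), Function.Injective cols ∧
        m = ((matA k p hp).submatrix id cols).det} := by
  exact le_antisymm (comap_le_minorsIdeal k p hp) (minorsIdeal_le_comap k p hp)
end

section
/- Every 3×3 minor of the 3×(2p-1) matrix A (with columns (1,e_p,e_{2p}), and (e_i,e_{p+i},0), (0,e_i,e_{p+i}) for 1 ≤ i ≤ p-1) lies in the ideal generated by the binomials e_i e_{p+j} − e_j e_{p+i} (1 ≤ i < j ≤ p-1) together with the polynomials e_{p+i}e_{p+j} − e_i e_{p+j} e_p + e_i e_j e_{2p} (1 ≤ i ≤ j ≤ p-1). -/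
/-- `Ev k p i` is the variable `e_i` of `k[e_1,…,e_{2p}]` for `1 ≤ i ≤ 2p`
(0-indexed internally), and `0` otherwise. -/
noncomputable def Ev (k : Type*) [Field k] (p : ℕ) :
    ℕ → MvPolynomial (Fin (2 * p)) k := fun i =>
  if h : 1 ≤ i ∧ i ≤ 2 * p then MvPolynomial.X ⟨i - 1, by omega⟩ else 0

/-- A `3 × 3` determinant vanishes when each column is `(1, s, t)`, `(a i, b i, 0)` or
`(0, a i, b i)`, provided `a` and `b` satisfy the binomial and quadratic relations. -/
theorem det_eq_zero_of_columns {R ι : Type*} [CommRing R] (P : ι → Prop) (a b : ι → R) (s t : R)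
    (hab : ∀ i j, P i → P j → a i * b j = a j * b i)
    (hbb : ∀ i j, P i → P j → b i * b j - a i * b j * s + a i * a j * t = 0)
    (M : Matrix (Fin 3) (Fin 3) R)
    (hM : ∀ c, (M 0 c = 1 ∧ M 1 c = s ∧ M 2 c = t) ∨
      (∃ i, P i ∧ M 0 c = a i ∧ M 1 c = b i ∧ M 2 c = 0) ∨
      (∃ i, P i ∧ M 0 c = 0 ∧ M 1 c = a i ∧ M 2 c = b i)) :
    M.det = 0 := by
  rw [Matrix.det_fin_three]
  rcases hM 0 with ⟨h1, h2, h3⟩ | ⟨i, hi, h1, h2, h3⟩ | ⟨i, hi, h1, h2, h3⟩ <;>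
  rcases hM 1 with ⟨h4, h5, h6⟩ | ⟨j, hj, h4, h5, h6⟩ | ⟨j, hj, h4, h5, h6⟩ <;>
  rcases hM 2 with ⟨h7, h8, h9⟩ | ⟨l, hl, h7, h8, h9⟩ | ⟨l, hl, h7, h8, h9⟩ <;>
  rw [h1, h2, h3, h4, h5, h6, h7, h8, h9] <;>
  grind only

/-- The columns of `matA` in terms of the variables `Ev`. -/
theorem matA_column (k : Type*) [Field k] (p : ℕ) (hp : 3 ≤ p) (c : Fin (2 * p - 1)) :
    (matA k p hp 0 c = 1 ∧ matA k p hp 1 c = Ev k p p ∧ matA k p hp 2 c = Ev k p (2 * p)) ∨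
    (∃ i, (1 ≤ i ∧ i ≤ p - 1) ∧ matA k p hp 0 c = Ev k p i ∧
      matA k p hp 1 c = Ev k p (p + i) ∧ matA k p hp 2 c = 0) ∨
    (∃ i, (1 ≤ i ∧ i ≤ p - 1) ∧ matA k p hp 0 c = 0 ∧
      matA k p hp 1 c = Ev k p i ∧ matA k p hp 2 c = Ev k p (p + i)) := by
  obtain ⟨c, hc⟩ := c
  have hEv : ∀ i, (h : 1 ≤ i ∧ i ≤ 2 * p) → Ev k p i = MvPolynomial.X ⟨i - 1, by omega⟩ :=
    fun i h => dif_pos h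
  by_cases h0 : c = 0
  · left
    rw [hEv p (by omega), hEv (2 * p) (by omega)]
    simp [matA, h0]
  right
  by_cases h1 : c % 2 = 1
  · refine Or.inl ⟨(c + 1) / 2, by omega, ?_⟩
    rw [hEv _ (by omega), hEv _ (by omega)]
    simp [matA, h0, h1]
  · refine Or.inr ⟨c / 2, by omega, ?_⟩
    rw [hEv _ (by omega), hEv _ (by omega)]
    simp [matA, h0, h1]

/-- every `3×3` minor of `A` lies in the ideal generated by the binomials
`e_i e_{p+j} − e_j e_{p+i}` (1 ≤ i < j ≤ p-1) together with the polynomials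
`e_{p+i} e_{p+j} − e_i e_{p+j} e_p + e_i e_j e_{2p}` (1 ≤ i ≤ j ≤ p-1). -/
theorem stmt12 (k : Type*) [Field k] (p : ℕ) (hp : 3 ≤ p) :
    ∀ cols : Fin 3 → Fin (2 * p - 1), Function.Injective cols →
      ((matA k p hp).submatrix id cols).det ∈
        Ideal.span
          ({f | ∃ i j : ℕ, 1 ≤ i ∧ i < j ∧ j ≤ p - 1 ∧
              f = Ev k p i * Ev k p (p + j) - Ev k p j * Ev k p (p + i)} ∪
            {f | ∃ i j : ℕ, 1 ≤ i ∧ i ≤ j ∧ j ≤ p - 1 ∧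
              f = Ev k p (p + i) * Ev k p (p + j) -
                Ev k p i * Ev k p (p + j) * Ev k p p +
                Ev k p i * Ev k p j * Ev k p (2 * p)}) := by
  intro cols _
  set I := Ideal.span (_ : Set (MvPolynomial (Fin (2 * p)) k)) with hI
  let q := Ideal.Quotient.mk I
  have hlt : ∀ i j : ℕ, 1 ≤ i → i < j → j ≤ p - 1 →
      q (Ev k p i) * q (Ev k p (p + j)) = q (Ev k p j) * q (Ev k p (p + i)) := by
    intro i j hi hij hj
    rw [← sub_eq_zero, ← map_mul, ← map_mul, ← map_sub]
    exact Ideal.Quotient.eq_zero_iff_mem.2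
      (Ideal.subset_span (Or.inl ⟨i, j, hi, hij, hj, rfl⟩))
  have hab : ∀ i j : ℕ, (1 ≤ i ∧ i ≤ p - 1) → (1 ≤ j ∧ j ≤ p - 1) →
      q (Ev k p i) * q (Ev k p (p + j)) = q (Ev k p j) * q (Ev k p (p + i)) := by
    intro i j hi hj
    rcases lt_trichotomy i j with h | rfl | h
    · exact hlt i j hi.1 h hj.2
    · rfl
    · exact (hlt j i hj.1 h hi.2).symm
  have hle : ∀ i j : ℕ, 1 ≤ i → i ≤ j → j ≤ p - 1 →
      q (Ev k p (p + i)) * q (Ev k p (p + j)) -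
        q (Ev k p i) * q (Ev k p (p + j)) * q (Ev k p p) +
        q (Ev k p i) * q (Ev k p j) * q (Ev k p (2 * p)) = 0 := by
    intro i j hi hij hj
    simp only [← map_mul, ← map_sub, ← map_add]
    exact Ideal.Quotient.eq_zero_iff_mem.2
      (Ideal.subset_span (Or.inr ⟨i, j, hi, hij, hj, rfl⟩))
  refine Ideal.Quotient.eq_zero_iff_mem.1 ?_
  change q _ = 0
  rw [RingHom.map_det]
  refine det_eq_zero_of_columns (fun i => 1 ≤ i ∧ i ≤ p - 1) (fun i => q (Ev k p i))
    (fun i => q (Ev k p (p + i))) (q (Ev k p p)) (q (Ev k p (2 * p))) hab ?_ _ ?_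
  · intro i j hi hj
    rcases le_total i j with h | h
    · exact hle i j hi.1 h hj.2
    · linear_combination hle j i hj.1 h hi.2 - q (Ev k p p) * hab i j hi hj
  · intro c
    simp only [RingHom.mapMatrix_apply, Matrix.map_apply, Matrix.submatrix_apply, id]
    rcases matA_column k p hp (cols c) with ⟨h0, h1, h2⟩ | ⟨i, hi, h0, h1, h2⟩ | ⟨i, hi, h0, h1, h2⟩
    · exact Or.inl (by simp [h0, h1, h2])
    · exact Or.inr (Or.inl ⟨i, hi, by simp [h0, h1, h2]⟩)
    · exact Or.inr (Or.inr ⟨i, hi, by simp [h0, h1, h2]⟩)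
end
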